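/- Let d ≥ 1 and n ≥ 1 and let μ be a partition of n into at most d parts. Then compressing the Haar-twirled unequal state by the symmetrizer yields the equal state up to the multinomial factor: Π_{(n)} · ρ_≠^μ · Π_{(n)} = (1/binom(n,μ)) · ρ_=^n. -/

import Mathlib

open MeasureTheory Matrix
open scoped ComplexOrder

noncomputable section

/-- The unitary group `U(d)`. -/
abbrev UG (d : ℕ) := Matrix.unitaryGroup (Fin d) ℂ

noncomputable instance (d : ℕ) : MeasurableSpace (UG d) := borel _

instance (d : ℕ) : BorelSpace (UG d) := ⟨rfl⟩

/-- The permutation matrix `ψ(π)` on `(ℂ^d)^{⊗n}`, with `(x,y)` entry `1` iff `y = x ∘ π`. -/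
def psi (d n : ℕ) (π : Equiv.Perm (Fin n)) : Matrix (Fin n → Fin d) (Fin n → Fin d) ℂ :=
  Matrix.of fun x y => if y = x ∘ π then 1 else 0

/-- The symmetrizer `Π_{(n)} = (1/n!) ∑_{π ∈ S_n} ψ(π)`. -/
def symmetrizer (d n : ℕ) : Matrix (Fin n → Fin d) (Fin n → Fin d) ℂ :=
  ((n.factorial : ℂ))⁻¹ • ∑ π : Equiv.Perm (Fin n), psi d n π

/-- The `n`-fold tensor power of a `d × d` matrix: `(U^{⊗n})_{x,y} = ∏ i, U_{x i, y i}`. -/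
def tpow (d n : ℕ) (U : Matrix (Fin d) (Fin d) ℂ) :
    Matrix (Fin n → Fin d) (Fin n → Fin d) ℂ :=
  Matrix.of fun x y => ∏ i, U (x i) (y i)

/-- The list consisting of `μ 0` copies of `0`, then `μ 1` copies of `1`, etc. -/
def wordList (d : ℕ) (μ : Fin d → ℕ) : List (Fin d) :=
  (List.ofFn fun i => List.replicate (μ i) i).flatten

lemma wordList_length (d : ℕ) (μ : Fin d → ℕ) : (wordList d μ).length = ∑ i, μ i := by
  simp [wordList, List.length_flatten, Function.comp, List.sum_ofFn]

/-- The word indexing the basis vector `|e_μ⟩`: the first `μ 0` tensor factors carry the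
first basis label, the next `μ 1` factors the second basis label, etc. -/
def word (d n : ℕ) (μ : Fin d → ℕ) (hsum : ∑ i, μ i = n) (j : Fin n) : Fin d :=
  (wordList d μ).get ⟨j, by rw [wordList_length, hsum]; exact j.isLt⟩

/-- `∫ U^{⊗n} |e_w⟩⟨e_w| (U^{⊗n})^† dq` for a basis word `w` (entrywise Bochner integral). -/
def rhoWord (d n : ℕ) (w : Fin n → Fin d) (q : Measure (UG d)) :
    Matrix (Fin n → Fin d) (Fin n → Fin d) ℂ :=
  Matrix.of fun x y =>
    ∫ U : UG d, tpow d n (U : Matrix (Fin d) (Fin d) ℂ) x w *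
      star (tpow d n (U : Matrix (Fin d) (Fin d) ℂ) y w) ∂q

/-- The Haar-twirled unequal state `ρ_≠^μ`. -/
def rhoNE (d n : ℕ) (μ : Fin d → ℕ) (hsum : ∑ i, μ i = n) (haar : Measure (UG d)) :
    Matrix (Fin n → Fin d) (Fin n → Fin d) ℂ :=
  rhoWord d n (word d n μ hsum) haar

/-- The partition `(n, 0, …, 0)`. -/
def muEq (d n : ℕ) (hd : 0 < d) : Fin d → ℕ := fun i => if i = ⟨0, hd⟩ then n else 0

lemma muEq_sum (d n : ℕ) (hd : 0 < d) : ∑ i, muEq d n hd i = n := by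
  simp [muEq]

/-- The equal state `ρ_=^n = ρ_≠^{(n,0,…,0)}`. -/
def rhoEQ (d n : ℕ) (hd : 0 < d) (haar : Measure (UG d)) :
    Matrix (Fin n → Fin d) (Fin n → Fin d) ℂ :=
  rhoNE d n (muEq d n hd) (muEq_sum d n hd) haar

/-- The set of POVM elements: Hermitian `P` with `0 ⪯ P ⪯ I`. -/
def POVMs (d n : ℕ) : Set (Matrix (Fin n → Fin d) (Fin n → Fin d) ℂ) :=
  {P | P.PosSemidef ∧ (1 - P).PosSemidef}

/-- The average success probability of the test `{P, I - P}` with prior `p` on the equal case. -/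
def successProb (d n : ℕ) (hd : 0 < d) (μ : Fin d → ℕ) (hsum : ∑ i, μ i = n)
    (haar : Measure (UG d)) (p : ℝ) (P : Matrix (Fin n → Fin d) (Fin n → Fin d) ℂ) : ℝ :=
  p * (Matrix.trace (P * rhoEQ d n hd haar)).re +
    (1 - p) * (1 - (Matrix.trace (P * rhoNE d n μ hsum haar)).re)

def vt {d n : ℕ} (v : Fin d → ℂ) (x : Fin n → Fin d) : ℂ := ∏ i, v (x i)

def Fq {d n : ℕ} (M : Matrix (Fin n → Fin d) (Fin n → Fin d) ℂ) (v : Fin d → ℂ) : ℂ :=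
  ∑ x, ∑ y, star (vt v x) * M x y * vt v y

def cnt {d n : ℕ} (x y : Fin n → Fin d) : Fin d ⊕ Fin d →₀ ℕ :=
  (∑ i, Finsupp.single (Sum.inl (x i)) 1) + ∑ i, Finsupp.single (Sum.inr (y i)) 1

def polyM {d n : ℕ} (M : Matrix (Fin n → Fin d) (Fin n → Fin d) ℂ) :
    MvPolynomial (Fin d ⊕ Fin d) ℂ :=
  ∑ x, ∑ y, MvPolynomial.monomial (cnt x y) (M x y)

lemma monomial_cnt {d n : ℕ} (x y : Fin n → Fin d) (c : ℂ) :
    MvPolynomial.monomial (cnt x y) c =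
      (∏ i, MvPolynomial.X (Sum.inl (x i))) * MvPolynomial.C c *
        ∏ i, MvPolynomial.X (Sum.inr (y i)) := by
  have h : ∀ s : Fin d ⊕ Fin d, (MvPolynomial.X s : MvPolynomial (Fin d ⊕ Fin d) ℂ)
      = MvPolynomial.monomial (Finsupp.single s 1) 1 := fun s => rfl
  simp only [h, ← MvPolynomial.monomial_sum_one]
  rw [MvPolynomial.C_apply, MvPolynomial.monomial_mul, MvPolynomial.monomial_mul]
  simp [cnt]

lemma eval_polyM {d n : ℕ} (M : Matrix (Fin n → Fin d) (Fin n → Fin d) ℂ)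
    (w : Fin d ⊕ Fin d → ℂ) :
    MvPolynomial.eval w (polyM M) =
      ∑ x, ∑ y, (∏ i, w (Sum.inl (x i))) * M x y * ∏ i, w (Sum.inr (y i)) := by
  simp [polyM, monomial_cnt, map_sum, map_prod]

lemma polyM_eq_zero {d n : ℕ} (M : Matrix (Fin n → Fin d) (Fin n → Fin d) ℂ)
    (h : ∀ v, Fq M v = 0) : polyM M = 0 := by
  set s : Fin d ⊕ Fin d → MvPolynomial (Fin d ⊕ Fin d) ℂ :=
    Sum.elim (fun j => MvPolynomial.X (Sum.inl j) - MvPolynomial.C Complex.I *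
        MvPolynomial.X (Sum.inr j))
      (fun j => MvPolynomial.X (Sum.inl j) + MvPolynomial.C Complex.I *
        MvPolynomial.X (Sum.inr j)) with hs
  have key : ∀ a : Fin d ⊕ Fin d → ℂ, MvPolynomial.eval a (MvPolynomial.bind₁ s (polyM M)) =
      MvPolynomial.eval (Sum.elim (fun j => a (Sum.inl j) - Complex.I * a (Sum.inr j))
        (fun j => a (Sum.inl j) + Complex.I * a (Sum.inr j))) (polyM M) := by
    intro a
    rw [← MvPolynomial.coe_aeval_eq_eval, ← MvPolynomial.coe_aeval_eq_eval]
    simp only [RingHom.coe_coe]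
    rw [MvPolynomial.aeval_bind₁]
    congr 2
    funext j
    rcases j with j | j <;> simp [hs]
  have hQ : MvPolynomial.bind₁ s (polyM M) = 0 := by
    refine MvPolynomial.funext_set (fun _ => Set.range (fun r : ℝ => (r : ℂ)))
      (fun _ => Set.infinite_range_of_injective Complex.ofReal_injective) ?_
    intro a ha
    have ha' : ∀ j, ∃ r : ℝ, (r : ℂ) = a j := fun j => ha j (Set.mem_univ _)
    choose r hr using ha'
    rw [key, eval_polyM, map_zero, ← h (fun j => a (Sum.inl j) + Complex.I * a (Sum.inr j))]
    unfold Fq vt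
    refine Finset.sum_congr rfl fun x _ => Finset.sum_congr rfl fun y _ => ?_
    congr 2
    rw [star_prod]
    refine Finset.prod_congr rfl fun i _ => ?_
    simp [← hr, sub_eq_add_neg]
  refine MvPolynomial.funext fun w => ?_
  have := key (Sum.elim (fun j => (w (Sum.inr j) + w (Sum.inl j)) / 2)
    (fun j => (w (Sum.inr j) - w (Sum.inl j)) / (2 * Complex.I)))
  rw [hQ, map_zero] at this
  rw [map_zero, this]
  congr 1
  have hI := Complex.I_ne_zero
  congr 1
  funext j
  rcases j with j | j
  · simp; field_simp; ring
  · simp; field_simp; ring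

lemma exists_perm_of_card {d n : ℕ} (x x' : Fin n → Fin d)
    (h : ∀ a, Fintype.card {i // x i = a} = Fintype.card {i // x' i = a}) :
    ∃ σ : Equiv.Perm (Fin n), x = x' ∘ σ := by
  refine ⟨Equiv.ofFiberEquiv (f := x) (g := x') fun a => Fintype.equivOfCardEq (h a), ?_⟩
  funext i
  exact (Equiv.ofFiberEquiv_map _ i).symm

lemma cnt_eq {d n : ℕ} {x y x' y' : Fin n → Fin d} (h : cnt x y = cnt x' y') :
    (∃ σ : Equiv.Perm (Fin n), x = x' ∘ σ) ∧ ∃ σ : Equiv.Perm (Fin n), y = y' ∘ σ := by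
  constructor
  · refine exists_perm_of_card _ _ fun a => ?_
    have := DFunLike.congr_fun h (Sum.inl a)
    simp only [cnt, Finsupp.add_apply, Finsupp.finsetSum_apply, Finsupp.single_apply] at this
    simp at this
    simpa [Fintype.card_subtype] using this
  · refine exists_perm_of_card _ _ fun a => ?_
    have := DFunLike.congr_fun h (Sum.inr a)
    simp only [cnt, Finsupp.add_apply, Finsupp.finsetSum_apply, Finsupp.single_apply] at this
    simp at this
    simpa [Fintype.card_subtype] using this

lemma polarize {d n : ℕ} (M : Matrix (Fin n → Fin d) (Fin n → Fin d) ℂ)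
    (hl : ∀ (σ : Equiv.Perm (Fin n)) x y, M (x ∘ σ) y = M x y)
    (hr : ∀ (σ : Equiv.Perm (Fin n)) x y, M x (y ∘ σ) = M x y)
    (h : ∀ v, Fq M v = 0) : M = 0 := by
  ext x₀ y₀
  have hP := polyM_eq_zero M h
  have hc := congrArg (MvPolynomial.coeff (cnt x₀ y₀)) hP
  simp only [polyM, MvPolynomial.coeff_sum, MvPolynomial.coeff_monomial,
    MvPolynomial.coeff_zero] at hc
  have : ∀ x y, (if cnt x y = cnt x₀ y₀ then M x y else 0) =
      (if cnt x y = cnt x₀ y₀ then 1 else 0) * M x₀ y₀ := by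
    intro x y
    split_ifs with hxy
    · obtain ⟨⟨σ, rfl⟩, ⟨τ, rfl⟩⟩ := cnt_eq hxy
      rw [hl, hr, one_mul]
    · simp
  simp only [this, ← Finset.sum_mul] at hc
  rcases mul_eq_zero.1 hc with h0 | h0
  · exfalso
    rw [← Finset.sum_product', Finset.sum_boole] at h0
    rw [Nat.cast_eq_zero, Finset.card_eq_zero] at h0
    have : (x₀, y₀) ∈ (∅ : Finset ((Fin n → Fin d) × (Fin n → Fin d))) := by
      rw [← h0]; simp
    simp at this
  · simpa using h0

lemma card_word (d n : ℕ) (μ : Fin d → ℕ) (hsum : ∑ i, μ i = n) (a : Fin d) :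
    Fintype.card {j // word d n μ hsum j = a} = μ a := by
  have hl : (wordList d μ).length = n := by rw [wordList_length, hsum]
  have h := Fin.card_filter_univ_eq_vector_get_eq_count a ⟨wordList d μ, hl⟩
  have hc : (wordList d μ).count a = μ a := by
    rw [wordList, List.count_flatten, List.map_ofFn, List.sum_ofFn]
    simp [List.count_replicate]
  rw [Fintype.card_subtype]
  exact h.trans hc

lemma word_muEq (d n : ℕ) (hd : 0 < d) (j : Fin n) :
    word d n (muEq d n hd) (muEq_sum d n hd) j = ⟨0, hd⟩ := by
  by_contra hne
  have h := card_word d n (muEq d n hd) (muEq_sum d n hd)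
    (word d n (muEq d n hd) (muEq_sum d n hd) j)
  rw [muEq, if_neg hne, Fintype.card_eq_zero_iff] at h
  exact h.false ⟨j, rfl⟩

lemma symm_entry {d n : ℕ} (M : Matrix (Fin n → Fin d) (Fin n → Fin d) ℂ)
    (x y : Fin n → Fin d) :
    (symmetrizer d n * M * symmetrizer d n) x y =
      ((n.factorial : ℂ))⁻¹ * ((n.factorial : ℂ))⁻¹ *
        ∑ π : Equiv.Perm (Fin n), ∑ σ : Equiv.Perm (Fin n), M (x ∘ π) (y ∘ σ) := by
  have h1 : ∀ (π : Equiv.Perm (Fin n)) (M : Matrix (Fin n → Fin d) (Fin n → Fin d) ℂ) x y,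
      (psi d n π * M) x y = M (x ∘ π) y := by
    intro π M x y
    simp [Matrix.mul_apply, psi]
  have h2 : ∀ (π : Equiv.Perm (Fin n)) (M : Matrix (Fin n → Fin d) (Fin n → Fin d) ℂ) x y,
      (M * psi d n π) x y = M x (y ∘ π.symm) := by
    intro π M x y
    have : ∀ z : Fin n → Fin d, y = z ∘ π ↔ z = y ∘ π.symm := by
      intro z
      rw [Equiv.eq_comp_symm]; exact eq_comm
    simp [Matrix.mul_apply, psi, this]
  simp only [symmetrizer, Matrix.smul_mul, Matrix.mul_smul, Matrix.smul_apply, smul_eq_mul,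
    Finset.sum_mul, Finset.mul_sum, Matrix.sum_apply, h1, h2]
  rw [Finset.sum_comm]
  refine Finset.sum_congr rfl fun π _ => ?_
  rw [← Equiv.sum_comp (Equiv.inv (Equiv.Perm (Fin n)))]
  refine Finset.sum_congr rfl fun σ _ => ?_
  have : ((Equiv.inv (Equiv.Perm (Fin n))) σ).symm = σ := by
    ext; simp [← Equiv.Perm.inv_def]
  rw [this]
  ring

lemma symm_left {d n : ℕ} (M : Matrix (Fin n → Fin d) (Fin n → Fin d) ℂ)
    (τ : Equiv.Perm (Fin n)) (x y : Fin n → Fin d) :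
    (symmetrizer d n * M * symmetrizer d n) (x ∘ τ) y =
      (symmetrizer d n * M * symmetrizer d n) x y := by
  rw [symm_entry, symm_entry]
  congr 1
  rw [← Equiv.sum_comp (Equiv.mulLeft τ)
    (fun π : Equiv.Perm (Fin n) => ∑ σ : Equiv.Perm (Fin n), M (x ∘ π) (y ∘ σ))]
  rfl

lemma symm_right {d n : ℕ} (M : Matrix (Fin n → Fin d) (Fin n → Fin d) ℂ)
    (τ : Equiv.Perm (Fin n)) (x y : Fin n → Fin d) :
    (symmetrizer d n * M * symmetrizer d n) x (y ∘ τ) =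
      (symmetrizer d n * M * symmetrizer d n) x y := by
  rw [symm_entry, symm_entry]
  congr 1
  refine Finset.sum_congr rfl fun π _ => ?_
  rw [← Equiv.sum_comp (Equiv.mulLeft τ) (fun σ : Equiv.Perm (Fin n) => M (x ∘ π) (y ∘ σ))]
  rfl

lemma vt_comp {d n : ℕ} (v : Fin d → ℂ) (x : Fin n → Fin d) (σ : Equiv.Perm (Fin n)) :
    vt v (x ∘ σ) = vt v x := by
  unfold vt
  exact Equiv.prod_comp σ (fun i => v (x i))

def compPerm {d n : ℕ} (σ : Equiv.Perm (Fin n)) : (Fin n → Fin d) ≃ (Fin n → Fin d) :=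
  σ.symm.arrowCongr (Equiv.refl _)

lemma compPerm_apply {d n : ℕ} (σ : Equiv.Perm (Fin n)) (x : Fin n → Fin d) :
    compPerm σ x = x ∘ σ := by
  funext i; simp [compPerm]

lemma fact_ne (n : ℕ) : (n.factorial : ℂ) ≠ 0 := by
  exact_mod_cast n.factorial_ne_zero

lemma Fq_symm {d n : ℕ} (M : Matrix (Fin n → Fin d) (Fin n → Fin d) ℂ) (v : Fin d → ℂ) :
    Fq (symmetrizer d n * M * symmetrizer d n) v = Fq M v := by
  have h : ∀ π σ : Equiv.Perm (Fin n),
      ∑ x, ∑ y, star (vt v x) * M (x ∘ π) (y ∘ σ) * vt v y = Fq M v := by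
    intro π σ
    unfold Fq
    rw [← Equiv.sum_comp (compPerm π) (fun x => ∑ y, star (vt v x) * M x y * vt v y)]
    refine Finset.sum_congr rfl fun x _ => ?_
    rw [← Equiv.sum_comp (compPerm σ) (fun y => star (vt v (compPerm π x)) *
      M (compPerm π x) y * vt v y)]
    refine Finset.sum_congr rfl fun y _ => ?_
    simp only [compPerm_apply, vt_comp]
  have h2 : Fq (symmetrizer d n * M * symmetrizer d n) v =
      ((n.factorial : ℂ))⁻¹ * ((n.factorial : ℂ))⁻¹ *
        ∑ π : Equiv.Perm (Fin n), ∑ σ : Equiv.Perm (Fin n),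
          ∑ x, ∑ y, star (vt v x) * M (x ∘ π) (y ∘ σ) * vt v y := by
    have e : ∀ f : (Fin n → Fin d) → (Fin n → Fin d) → Equiv.Perm (Fin n) →
        Equiv.Perm (Fin n) → ℂ,
        ∑ x, ∑ y, ∑ π, ∑ σ, f x y π σ = ∑ π, ∑ σ, ∑ x, ∑ y, f x y π σ := by
      intro f
      calc _ = ∑ x, ∑ π, ∑ y, ∑ σ, f x y π σ :=
            Finset.sum_congr rfl fun x _ => Finset.sum_comm
        _ = ∑ π, ∑ x, ∑ y, ∑ σ, f x y π σ := Finset.sum_comm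
        _ = ∑ π, ∑ x, ∑ σ, ∑ y, f x y π σ :=
            Finset.sum_congr rfl fun π _ => Finset.sum_congr rfl fun x _ => Finset.sum_comm
        _ = _ := Finset.sum_congr rfl fun π _ => Finset.sum_comm
    rw [← e]
    unfold Fq
    simp only [symm_entry, Finset.mul_sum, Finset.sum_mul]
    refine Finset.sum_congr rfl fun x _ => Finset.sum_congr rfl fun y _ =>
      Finset.sum_congr rfl fun π _ => Finset.sum_congr rfl fun σ _ => ?_
    ring
  rw [h2]
  simp only [h]
  have := fact_ne n
  simp [Fintype.card_perm]
  field_simp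

lemma trace_symm {d n : ℕ} (M : Matrix (Fin n → Fin d) (Fin n → Fin d) ℂ) :
    Matrix.trace (symmetrizer d n * M * symmetrizer d n) =
      ((n.factorial : ℂ))⁻¹ * ∑ π : Equiv.Perm (Fin n), ∑ x, M x (x ∘ π) := by
  have h : ∀ π : Equiv.Perm (Fin n), ∑ σ : Equiv.Perm (Fin n), ∑ x, M (x ∘ π) (x ∘ σ) =
      ∑ σ : Equiv.Perm (Fin n), ∑ x, M x (x ∘ σ) := by
    intro π
    rw [← Equiv.sum_comp (Equiv.mulLeft π)]
    refine Finset.sum_congr rfl fun σ _ => ?_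
    rw [← Equiv.sum_comp (compPerm π) (fun x => M x (x ∘ σ))]
    refine Finset.sum_congr rfl fun x _ => ?_
    rw [compPerm_apply]
    rfl
  unfold Matrix.trace
  simp only [Matrix.diag_apply, symm_entry]
  rw [← Finset.mul_sum, Finset.sum_comm]
  have h2 : ∀ π : Equiv.Perm (Fin n), ∑ x, ∑ σ : Equiv.Perm (Fin n), M (x ∘ π) (x ∘ σ) =
      ∑ σ : Equiv.Perm (Fin n), ∑ x, M x (x ∘ σ) := by
    intro π; rw [Finset.sum_comm, h]
  simp only [h2]
  have := fact_ne n
  simp [Fintype.card_perm]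
  field_simp

lemma symm_eq_self {d n : ℕ} (M : Matrix (Fin n → Fin d) (Fin n → Fin d) ℂ)
    (hl : ∀ (σ : Equiv.Perm (Fin n)) x y, M (x ∘ σ) y = M x y)
    (hr : ∀ (σ : Equiv.Perm (Fin n)) x y, M x (y ∘ σ) = M x y) :
    symmetrizer d n * M * symmetrizer d n = M := by
  ext x y
  rw [symm_entry]
  simp only [hl, hr]
  have := fact_ne n
  simp [Fintype.card_perm]
  field_simp

lemma integrable_term {d n : ℕ} (x y w : Fin n → Fin d) (q : Measure (UG d))
    [IsProbabilityMeasure q] :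
    Integrable (fun U : UG d => tpow d n (U : Matrix (Fin d) (Fin d) ℂ) x w *
      star (tpow d n (U : Matrix (Fin d) (Fin d) ℂ) y w)) q := by
  have hc : ∀ x : Fin n → Fin d,
      Continuous (fun U : UG d => tpow d n (U : Matrix (Fin d) (Fin d) ℂ) x w) := by
    intro x
    simp only [tpow, Matrix.of_apply]
    exact continuous_finsetProd _ fun i _ => continuous_subtype_val.matrix_elem _ _
  have hb : ∀ (x : Fin n → Fin d) (U : UG d),
      ‖tpow d n (U : Matrix (Fin d) (Fin d) ℂ) x w‖ ≤ 1 := by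
    intro x U
    simp only [tpow, Matrix.of_apply, norm_prod]
    exact Finset.prod_le_one (fun i _ => norm_nonneg _)
      fun i _ => entry_norm_bound_of_unitary U.2 _ _
  refine Integrable.of_bound (((hc x).mul (hc y).star).aestronglyMeasurable) 1 ?_
  refine Filter.Eventually.of_forall fun U => ?_
  rw [norm_mul, norm_star]
  exact mul_le_one₀ (hb x U) (norm_nonneg _) (hb y U)

lemma sum_rho {d n : ℕ} (w : Fin n → Fin d) (q : Measure (UG d))
    [IsProbabilityMeasure q] (π : Equiv.Perm (Fin n)) :
    ∑ x, rhoWord d n w q x (x ∘ π) = if w ∘ π = w then 1 else 0 := by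
  simp only [rhoWord, Matrix.of_apply]
  rw [← integral_finsetSum _ fun x _ => integrable_term _ _ _ _]
  have h : ∀ U : UG d, ∑ x, tpow d n (U : Matrix (Fin d) (Fin d) ℂ) x w *
      star (tpow d n (U : Matrix (Fin d) (Fin d) ℂ) (x ∘ π) w) =
        if w ∘ π = w then 1 else 0 := by
    intro U
    have hU : ∀ a b : Fin d, ∑ c, (U : Matrix (Fin d) (Fin d) ℂ) c (a) *
        star ((U : Matrix (Fin d) (Fin d) ℂ) c b) = if a = b then 1 else 0 := by
      intro a b
      have := congrFun (congrFun (Matrix.mem_unitaryGroup_iff'.1 U.2) b) a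
      rw [Matrix.mul_apply, Matrix.one_apply] at this
      simp only [Matrix.star_apply] at this
      rw [← Finset.sum_congr rfl fun c _ => mul_comm _ _, this]
      simp [eq_comm]
    have h1 : ∀ x : Fin n → Fin d, tpow d n (U : Matrix (Fin d) (Fin d) ℂ) x w *
      star (tpow d n (U : Matrix (Fin d) (Fin d) ℂ) (x ∘ π) w) =
        ∏ i, ((U : Matrix (Fin d) (Fin d) ℂ) (x i) (w i) *
          star ((U : Matrix (Fin d) (Fin d) ℂ) (x i) (w (π.symm i)))) := by
      intro x
      rw [Finset.prod_mul_distrib]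
      simp only [tpow, Matrix.of_apply, star_prod]
      congr 1
      rw [← Equiv.prod_comp π (fun i =>
        star ((U : Matrix (Fin d) (Fin d) ℂ) (x i) (w (π.symm i))))]
      simp
    simp only [h1]
    rw [← Fintype.prod_sum (fun i c => (U : Matrix (Fin d) (Fin d) ℂ) c (w i) *
          star ((U : Matrix (Fin d) (Fin d) ℂ) c (w (π.symm i))))]
    simp only [hU]
    rw [Finset.prod_ite_zero]
    simp only [Finset.prod_const_one]
    congr 1
    have : w ∘ π = w ↔ w = w ∘ π.symm := by
      rw [Equiv.eq_comp_symm]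
    rw [this, funext_iff]
    simp
  simp only [h]
  simp

lemma trace_rho {d n : ℕ} (μ : Fin d → ℕ) (hsum : ∑ i, μ i = n) (q : Measure (UG d))
    [IsProbabilityMeasure q] :
    Matrix.trace (symmetrizer d n * rhoNE d n μ hsum q * symmetrizer d n) =
      ((Nat.multinomial Finset.univ μ : ℂ))⁻¹ := by
  rw [trace_symm, rhoNE]
  simp only [sum_rho]
  rw [Finset.sum_boole]
  have h := DomMulAct.stabilizer_card (word d n μ hsum)
  simp only [card_word] at h
  rw [Fintype.card_subtype] at h
  rw [h]
  have hm := Nat.multinomial_spec Finset.univ μ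
  rw [hsum] at hm
  have h0 := fact_ne n
  rw [← hm] at h0 ⊢
  push_cast at h0 ⊢
  have := left_ne_zero_of_mul h0
  have := right_ne_zero_of_mul h0
  field_simp

def gU {d n : ℕ} (w : Fin n → Fin d) (v : Fin d → ℂ) (U : Matrix (Fin d) (Fin d) ℂ) : ℂ :=
  ∏ i, ∑ a, star (v a) * U a (w i)

lemma Fq_rho {d n : ℕ} (w : Fin n → Fin d) (q : Measure (UG d)) [IsProbabilityMeasure q]
    (v : Fin d → ℂ) :
    Fq (rhoWord d n w q) v =
      ∫ U : UG d, gU w v (U : Matrix (Fin d) (Fin d) ℂ) *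
        star (gU w v (U : Matrix (Fin d) (Fin d) ℂ)) ∂q := by
  have hg : ∀ U : Matrix (Fin d) (Fin d) ℂ,
      gU w v U = ∑ x : Fin n → Fin d, star (vt v x) * tpow d n U x w := by
    intro U
    rw [gU, Fintype.prod_sum]
    refine Finset.sum_congr rfl fun x _ => ?_
    simp [vt, tpow, Finset.prod_mul_distrib]
  have hgg : ∀ U : Matrix (Fin d) (Fin d) ℂ,
      gU w v U * star (gU w v U) = ∑ x : Fin n → Fin d, ∑ y : Fin n → Fin d,
        star (vt v x) * (tpow d n U x w * star (tpow d n U y w)) * vt v y := by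
    intro U
    rw [hg, star_sum, Finset.sum_mul_sum]
    refine Finset.sum_congr rfl fun x _ => Finset.sum_congr rfl fun y _ => ?_
    rw [star_mul, star_star]
    ring
  simp only [hgg]
  have hi : ∀ x y : Fin n → Fin d, Integrable (fun U : UG d => star (vt v x) *
      (tpow d n (U : Matrix (Fin d) (Fin d) ℂ) x w *
        star (tpow d n (U : Matrix (Fin d) (Fin d) ℂ) y w)) * vt v y) q :=
    fun x y => ((integrable_term x y w q).const_mul _).mul_const _
  rw [integral_finsetSum _ fun x _ => integrable_finsetSum _ fun y _ => hi x y]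
  unfold Fq
  refine Finset.sum_congr rfl fun x _ => ?_
  rw [integral_finsetSum _ fun y _ => hi x y]
  refine Finset.sum_congr rfl fun y _ => ?_
  rw [integral_mul_const, integral_const_mul]
  rfl

lemma gU_mulVec {d n : ℕ} (w : Fin n → Fin d) (v : Fin d → ℂ) (U V : Matrix (Fin d) (Fin d) ℂ) :
    gU w (V *ᵥ v) U = gU w v (star V * U) := by
  unfold gU
  refine Finset.prod_congr rfl fun i _ => ?_
  simp only [Matrix.mulVec, dotProduct, Matrix.mul_apply, star_sum, star_mul, Finset.sum_mul,
    Finset.mul_sum, Matrix.star_apply]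
  rw [Finset.sum_comm]
  refine Finset.sum_congr rfl fun x _ => Finset.sum_congr rfl fun y _ => ?_
  ring

lemma Fq_rho_mulVec {d n : ℕ} (w : Fin n → Fin d) (q : Measure (UG d)) [IsProbabilityMeasure q]
    (hinv : ∀ V : UG d, Measure.map (fun U => V * U) q = q)
    (V : UG d) (v : Fin d → ℂ) :
    Fq (rhoWord d n w q) ((V : Matrix (Fin d) (Fin d) ℂ) *ᵥ v) = Fq (rhoWord d n w q) v := by
  rw [Fq_rho, Fq_rho]
  simp only [gU_mulVec]
  have hcont : Continuous (fun U : UG d => gU w v (U : Matrix (Fin d) (Fin d) ℂ) *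
        star (gU w v (U : Matrix (Fin d) (Fin d) ℂ))) := by
    have : Continuous (fun U : UG d => gU w v (U : Matrix (Fin d) (Fin d) ℂ)) := by
      unfold gU
      exact continuous_finsetProd _ fun i _ => continuous_finsetSum _ fun a _ =>
        continuous_const.mul (continuous_subtype_val.matrix_elem _ _)
    exact this.mul this.star
  have hm : AEMeasurable (fun U : UG d => star V * U) q :=
    (continuous_const.mul continuous_id).measurable.aemeasurable
  have h := integral_map hm (f := fun U : UG d => gU w v (U : Matrix (Fin d) (Fin d) ℂ) *
        star (gU w v (U : Matrix (Fin d) (Fin d) ℂ))) hcont.aestronglyMeasurable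
  rw [hinv (star V)] at h
  rw [h]
  rfl

lemma Fq_smul {d n : ℕ} (M : Matrix (Fin n → Fin d) (Fin n → Fin d) ℂ) (v : Fin d → ℂ) (r : ℂ) :
    Fq M (r • v) = star (r ^ n) * r ^ n * Fq M v := by
  have h : ∀ x : Fin n → Fin d, vt (r • v) x = r ^ n * vt v x := by
    intro x
    simp [vt, Finset.prod_mul_distrib]
  unfold Fq
  simp only [h, Finset.mul_sum, star_mul]
  refine Finset.sum_congr rfl fun x _ => Finset.sum_congr rfl fun y _ => ?_
  ring

lemma exists_unitary {d : ℕ} (a : Fin d) (v : Fin d → ℂ) :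
    ∃ (r : ℂ) (V : UG d), v = r • ((V : Matrix (Fin d) (Fin d) ℂ) *ᵥ Pi.single a 1) := by
  by_cases hv : v = 0
  · exact ⟨0, 1, by simp [hv]⟩
  let v' : EuclideanSpace ℂ (Fin d) := WithLp.toLp 2 v
  have hv' : v' ≠ 0 := by
    intro h
    apply hv
    funext i
    exact congrArg (fun z : EuclideanSpace ℂ (Fin d) => z i) h
  have hn : ‖v'‖ ≠ 0 := norm_ne_zero_iff.2 hv'
  let u : EuclideanSpace ℂ (Fin d) := ((‖v'‖ : ℂ)⁻¹) • v'
  have hu : ‖u‖ = 1 := by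
    simp [u, norm_smul, hn]
  have ho : Orthonormal ℂ (({a} : Set (Fin d)).domRestrict (fun _ => u)) := by
    constructor
    · intro i; exact hu
    · intro i j hij
      exact absurd (Subsingleton.elim i j) hij
  obtain ⟨b, hb⟩ := ho.exists_orthonormalBasis_extension_of_card_eq (by simp)
  have hU := (EuclideanSpace.basisFun (Fin d) ℂ).toMatrix_orthonormalBasis_mem_unitary b
  refine ⟨(‖v'‖ : ℂ), ⟨_, hU⟩, ?_⟩
  funext i
  have hba := hb a rfl
  have hnc : (‖v'‖ : ℂ) ≠ 0 := by exact_mod_cast hn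
  simp only [Matrix.mulVec_single_one, Pi.smul_apply, Matrix.col_apply, smul_eq_mul,
    Module.Basis.toMatrix_apply, hba]
  simp [u]
  field_simp
  rfl

/-- `Π_{(n)} ρ_≠^μ Π_{(n)} = (1/binom(n,μ)) ρ_=^n`. -/
theorem symmetrizer_compress_rhoNE (d n : ℕ) (hd : 1 ≤ d) (hn : 1 ≤ n)
    (μ : Fin d → ℕ) (hmono : ∀ i j : Fin d, i ≤ j → μ j ≤ μ i) (hsum : ∑ i, μ i = n)
    (haar : Measure (UG d)) [IsProbabilityMeasure haar]
    (hinv : ∀ V : UG d, Measure.map (fun U => V * U) haar = haar) :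
    symmetrizer d n * rhoNE d n μ hsum haar * symmetrizer d n
      = ((Nat.multinomial Finset.univ μ : ℂ))⁻¹ • rhoEQ d n (by omega) haar := by
  have hd0 : 0 < d := hd
  set a : Fin d := ⟨0, hd0⟩ with ha
  set e : Fin d → ℂ := Pi.single a 1 with he
  have hw : word d n (muEq d n hd0) (muEq_sum d n hd0) = fun _ => a :=
    funext fun j => word_muEq d n hd0 j
  set N := rhoEQ d n hd0 haar with hN
  set w := word d n μ hsum with hwμ
  have hNw : N = rhoWord d n (fun _ => a) haar := by
    rw [hN, rhoEQ, rhoNE, hw]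
  have htp : ∀ (U : Matrix (Fin d) (Fin d) ℂ) (σ : Equiv.Perm (Fin n)) (x : Fin n → Fin d),
      tpow d n U (x ∘ σ) (fun _ => a) = tpow d n U x (fun _ => a) := by
    intro U σ x
    exact Equiv.prod_comp σ (fun i => U (x i) a)
  have hNl : ∀ (σ : Equiv.Perm (Fin n)) x y, N (x ∘ σ) y = N x y := by
    intro σ x y
    simp only [hNw, rhoWord, Matrix.of_apply, htp]
  have hNr : ∀ (σ : Equiv.Perm (Fin n)) x y, N x (y ∘ σ) = N x y := by
    intro σ x y
    simp only [hNw, rhoWord, Matrix.of_apply, htp]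
  set M := symmetrizer d n * rhoNE d n μ hsum haar * symmetrizer d n with hM
  have htrN : Matrix.trace N = 1 := by
    have h1 : symmetrizer d n * N * symmetrizer d n = N := symm_eq_self N hNl hNr
    have h2 := trace_rho (muEq d n hd0) (muEq_sum d n hd0) haar
    change Matrix.trace (symmetrizer d n * N * symmetrizer d n) = _ at h2
    rw [h1] at h2
    rw [h2]
    have hm := Nat.multinomial_spec Finset.univ (muEq d n hd0)
    rw [muEq_sum] at hm
    have hp : ∏ i, (muEq d n hd0 i).factorial = n.factorial := by
      rw [Finset.prod_eq_single a]
      · simp [muEq, ha]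
      · intro b _ hb
        simp only [muEq, ← ha, if_neg hb, Nat.factorial_zero]
      · simp
    rw [hp] at hm
    have : Nat.multinomial Finset.univ (muEq d n hd0) = 1 :=
      Nat.eq_of_mul_eq_mul_left n.factorial_pos (by rw [hm, mul_one])
    rw [this]
    simp
  have htrM : Matrix.trace M = ((Nat.multinomial Finset.univ μ : ℂ))⁻¹ := trace_rho μ hsum haar
  have hFM : ∀ v, Fq M v = Fq (rhoWord d n w haar) v := fun v => Fq_symm _ v
  have hF : ∀ (w : Fin n → Fin d) (r : ℂ) (V : UG d),
      Fq (rhoWord d n w haar) (r • ((V : Matrix (Fin d) (Fin d) ℂ) *ᵥ e)) =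
        star (r ^ n) * r ^ n * Fq (rhoWord d n w haar) e := by
    intro w r V
    rw [Fq_smul, Fq_rho_mulVec w haar hinv]
  have hlin : ∀ (c c' : ℂ) v, Fq (c • M - c' • N) v = c * Fq M v - c' * Fq N v := by
    intro c c' v
    unfold Fq
    simp only [Finset.mul_sum, ← Finset.sum_sub_distrib]
    refine Finset.sum_congr rfl fun x _ => Finset.sum_congr rfl fun y _ => ?_
    simp only [Matrix.sub_apply, Matrix.smul_apply, smul_eq_mul]
    ring
  have hA : (Fq N e) • M - (Fq M e) • N = 0 := by
    refine polarize _ ?_ ?_ ?_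
    · intro σ x y
      simp only [Matrix.sub_apply, Matrix.smul_apply, hNl, hM, symm_left]
    · intro σ x y
      simp only [Matrix.sub_apply, Matrix.smul_apply, hNr, hM, symm_right]
    · intro v
      obtain ⟨r, V, rfl⟩ := exists_unitary a v
      rw [hlin, hFM, hFM, hNw, ← he, hF, hF]
      ring
  have hc : Fq N e ≠ 0 := by
    intro h0
    have : N = 0 := by
      refine polarize N hNl hNr fun v => ?_
      obtain ⟨r, V, rfl⟩ := exists_unitary a v
      rw [hNw, ← he, hF, ← hNw, h0, mul_zero]
    rw [this] at htrN
    simp at htrN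
  have ht := congrArg Matrix.trace hA
  rw [Matrix.trace_sub, Matrix.trace_smul, Matrix.trace_smul, htrN, htrM, Matrix.trace_zero] at ht
  simp only [smul_eq_mul, mul_one] at ht
  rw [← sub_eq_zero.1 ht, mul_smul, ← smul_sub] at hA
  exact sub_eq_zero.1 ((smul_eq_zero.1 hA).resolve_left hc)

end
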